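/- For every k ≥ 3 there is a constant c_k depending only on k with the following property. Let G = (V, E) be a simple loopless graph containing at most one k-clique (as a set of vertices), and consider the query Q_k = (⋈_{i≠j∈[k]} R_{i,j}(v_i, v_j)) ⋈ U(v_1, …, v_k) with any fixed GAO, on the instance R_{i,j} = { (u, v) : {u, v} ∈ E } for all i ≠ j, and U = V^k. Then this instance admits a certificate of size at most c_k · (|E| + log(|V| + 2)). -/

import Mathlib

/-! Core model of indexed natural-join queries, arguments and certificates. -/

/-- `x` is a valid index tuple for a search tree with fanout function `f` and depth
(arity) `ar`: it is nonempty, of length at most `ar`, and every coordinate is `1`-based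
and within the fanout of the corresponding prefix. -/
def ValidIdx (f : List ℕ → ℕ) (ar : ℕ) (x : List ℕ) : Prop :=
  x ≠ [] ∧ x.length ≤ ar ∧
    ∀ j : Fin x.length, 1 ≤ x.get j ∧ x.get j ≤ f (x.take j.val)

/-- `v` is a valid valuation (a "database instance") for the search-tree shape `(f, ar)`:
the values assigned to the children of a common prefix strictly increase. -/
def IsInstVal (f : List ℕ → ℕ) (ar : ℕ) (v : List ℕ → ℕ) : Prop :=
  ∀ (x : List ℕ) (i : ℕ), ValidIdx f ar (x ++ [i]) → ValidIdx f ar (x ++ [i + 1]) →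
    v (x ++ [i]) < v (x ++ [i + 1])

/-- A symbolic comparison `R[x] θ S[y]` between two variables, `θ ∈ {<, =, >}`. -/
structure Comp (ι : Type) where
  R : ι
  x : List ℕ
  S : ι
  y : List ℕ
  o : Ordering
deriving DecidableEq

variable {n : ℕ} {ι : Type}

/-- The list of attributes of relation `R`, in the order of the GAO `ρ`. -/
def attrList (attrs : ι → Finset (Fin n)) (ρ : List (Fin n)) (R : ι) : List (Fin n) :=
  ρ.filter (fun a => decide (a ∈ attrs R))

/-- The arity of relation `R`. -/
def arity (attrs : ι → Finset (Fin n)) (ρ : List (Fin n)) (R : ι) : ℕ :=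
  (attrList attrs ρ R).length

/-- Well-formedness of a comparison: both index tuples are valid, and the two variables
are on the same attribute. -/
def CompWF (attrs : ι → Finset (Fin n)) (ρ : List (Fin n)) (f : ι → List ℕ → ℕ)
    (c : Comp ι) : Prop :=
  ValidIdx (f c.R) (arity attrs ρ c.R) c.x ∧
  ValidIdx (f c.S) (arity attrs ρ c.S) c.y ∧
  (attrList attrs ρ c.R)[c.x.length - 1]? = (attrList attrs ρ c.S)[c.y.length - 1]?

/-- The valuation `v` satisfies the comparison `c`. -/
def SatComp (v : ι → List ℕ → ℕ) (c : Comp ι) : Prop :=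
  compare (v c.R c.x) (v c.S c.y) = c.o

/-- `W` is a witness: one full valid index tuple per relation, all contributing to a common
output tuple `t`. -/
def IsWitness (attrs : ι → Finset (Fin n)) (ρ : List (Fin n)) (f : ι → List ℕ → ℕ)
    (v : ι → List ℕ → ℕ) (W : ι → List ℕ) : Prop :=
  (∀ R, ValidIdx (f R) (arity attrs ρ R) (W R) ∧ (W R).length = arity attrs ρ R) ∧
  ∃ t : Fin n → ℕ, ∀ (R : ι) (j : ℕ) (a : Fin n),
    (attrList attrs ρ R)[j]? = some a → v R ((W R).take (j + 1)) = t a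

/-- `A` is a certificate for the shape `f`: all its comparisons are well-formed, and any two
valuations (database instances with this index structure) satisfying all comparisons of `A`
have exactly the same witnesses. -/
def IsCert (attrs : ι → Finset (Fin n)) (ρ : List (Fin n)) (f : ι → List ℕ → ℕ)
    (A : Finset (Comp ι)) : Prop :=
  (∀ c ∈ A, CompWF attrs ρ f c) ∧
  ∀ v v' : ι → List ℕ → ℕ,
    (∀ R, IsInstVal (f R) (arity attrs ρ R) (v R)) →
    (∀ R, IsInstVal (f R) (arity attrs ρ R) (v' R)) →
    (∀ c ∈ A, SatComp v c) → (∀ c ∈ A, SatComp v' c) →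
    ∀ W, IsWitness attrs ρ f v W ↔ IsWitness attrs ρ f v' W

/-! The search tree (trie) derived from raw relational data. -/

/-- The `k`-th smallest element of a finite set of naturals (`1`-based). -/
def nthVal (s : Finset ℕ) (k : ℕ) : ℕ := (s.sort (· ≤ ·)).getD (k - 1) 0

/-- The list of values along the path of index tuple `x` in the search tree of the data
`D` with attribute list `L`. -/
def dbValList : List ℕ → Finset (Fin n → ℕ) → List (Fin n) → List ℕ
  | [], _, _ => []
  | _ :: _, _, [] => []
  | i :: xs, D, a :: L' =>
    let w := nthVal (D.image (fun t => t a)) i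
    w :: dbValList xs (D.filter (fun t => t a = w)) L'

/-- The fanout below index tuple `x` in the search tree of the data `D` with attribute
list `L`. -/
def dbFanout : List ℕ → Finset (Fin n → ℕ) → List (Fin n) → ℕ
  | _, _, [] => 0
  | [], D, a :: _ => (D.image (fun t => t a)).card
  | i :: xs, D, a :: L' =>
    let w := nthVal (D.image (fun t => t a)) i
    dbFanout xs (D.filter (fun t => t a = w)) L'

/-- The index structure (shape) of the database `DB`, indexed consistently with the GAO
`ρ`. -/
def dbShape (attrs : ι → Finset (Fin n)) (ρ : List (Fin n))
    (DB : ι → Finset (Fin n → ℕ)) : ι → List ℕ → ℕ :=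
  fun R x => dbFanout x (DB R) (attrList attrs ρ R)

/-- The value of the variable `R[x]` in the search trees of the database `DB`, indexed
consistently with the GAO `ρ`. -/
def dbValue (attrs : ι → Finset (Fin n)) (ρ : List (Fin n))
    (DB : ι → Finset (Fin n → ℕ)) : ι → List ℕ → ℕ :=
  fun R x => (dbValList x (DB R) (attrList attrs ρ R)).getD (x.length - 1) 0

/-- Relation indices for the clique query `Q_k`: one binary relation `R_{i,j}` for every
ordered pair `i ≠ j`, plus the full relation `U(v_1, …, v_k)`. -/
abbrev CliqueIdx (k : ℕ) : Type := {p : Fin k × Fin k // p.1 ≠ p.2} ⊕ Unit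

/-- Attribute sets of the clique query: `R_{i,j}` has attributes `{v_i, v_j}` and `U` has
all `k` attributes. -/
def cliqueAttrs (k : ℕ) : CliqueIdx k → Finset (Fin k)
  | Sum.inl p => {p.val.1, p.val.2}
  | Sum.inr _ => Finset.univ

/-- The data of the clique-query instance on a graph `G` on `Fin N`: each `R_{i,j}` holds
the (ordered) edges of `G`, and `U = V^k`. -/
noncomputable def cliqueDB (k N : ℕ) (G : SimpleGraph (Fin N)) :
    CliqueIdx k → Finset (Fin k → ℕ)
  | Sum.inl p =>
      (@Finset.filter _ (fun q : Fin N × Fin N => G.Adj q.1 q.2)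
          (Classical.decPred _) Finset.univ).image
        (fun q => fun a =>
          if a = p.val.1 then (q.1 : ℕ) else if a = p.val.2 then (q.2 : ℕ) else 0)
  | Sum.inr _ => (Finset.univ : Finset (Fin k → Fin N)).image (fun g => fun a => (g a : ℕ))

/-! ### Paths in the search tree of a relation -/

theorem nthVal_mem {s : Finset ℕ} {i : ℕ} (h1 : 1 ≤ i) (h2 : i ≤ s.card) : nthVal s i ∈ s := by
  have h : i - 1 < (s.sort (· ≤ ·)).length := by rw [Finset.length_sort]; omega
  rw [nthVal, List.getD_eq_getElem _ _ h]
  exact (Finset.mem_sort _).1 (List.getElem_mem h)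

theorem nthVal_injOn {s : Finset ℕ} {i j : ℕ} (hi1 : 1 ≤ i) (hi2 : i ≤ s.card) (hj1 : 1 ≤ j)
    (hj2 : j ≤ s.card) (h : nthVal s i = nthVal s j) : i = j := by
  have hi : i - 1 < (s.sort (· ≤ ·)).length := by rw [Finset.length_sort]; omega
  have hj : j - 1 < (s.sort (· ≤ ·)).length := by rw [Finset.length_sort]; omega
  rw [nthVal, nthVal, List.getD_eq_getElem _ _ hi, List.getD_eq_getElem _ _ hj] at h
  have := (Finset.sort_nodup s (· ≤ ·)).getElem_inj_iff.1 h
  omega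

theorem nthVal_range {N i : ℕ} (h1 : 1 ≤ i) (h2 : i ≤ N) :
    nthVal (Finset.range N) i = i - 1 := by
  have h : i - 1 < N := by omega
  simp [nthVal, Finset.sort_range, h]

/-- `x` is a (possibly empty) index path in the search tree of the data `D` with attribute
list `L`. -/
def IsPath : List ℕ → Finset (Fin n → ℕ) → List (Fin n) → Prop
  | [], _, _ => True
  | _ :: _, _, [] => False
  | i :: xs, D, a :: L =>
    (1 ≤ i ∧ i ≤ (D.image (fun t => t a)).card) ∧
      IsPath xs (D.filter (fun t => t a = nthVal (D.image (fun t => t a)) i)) L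

theorem isPath_iff_forall_get (x : List ℕ) (D : Finset (Fin n → ℕ)) (L : List (Fin n)) :
    IsPath x D L ↔ x.length ≤ L.length ∧
      ∀ j : Fin x.length, 1 ≤ x.get j ∧ x.get j ≤ dbFanout (x.take j.val) D L := by
  induction x generalizing D L with
  | nil => simp [IsPath]
  | cons i xs ih =>
    cases L with
    | nil => simp [IsPath]
    | cons a L =>
      rw [IsPath, ih]
      simp only [List.length_cons, Nat.add_le_add_iff_right]
      rw [Fin.forall_fin_succ (P := fun j : Fin (xs.length + 1) => 1 ≤ (i :: xs).get j ∧
        (i :: xs).get j ≤ dbFanout ((i :: xs).take j.val) D (a :: L))]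
      simp [dbFanout]
      tauto

theorem validIdx_dbFanout_iff (x : List ℕ) (D : Finset (Fin n → ℕ)) (L : List (Fin n)) :
    ValidIdx (fun y => dbFanout y D L) L.length x ↔ x ≠ [] ∧ IsPath x D L := by
  rw [isPath_iff_forall_get]; rfl

theorem isPath_append_singleton (x : List ℕ) (i : ℕ) (D : Finset (Fin n → ℕ))
    (L : List (Fin n)) :
    IsPath (x ++ [i]) D L ↔
      IsPath x D L ∧ x.length < L.length ∧ 1 ≤ i ∧ i ≤ dbFanout x D L := by
  induction x generalizing D L with
  | nil => cases L <;> simp [IsPath, dbFanout]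
  | cons j xs ih =>
    cases L with
    | nil => simp [IsPath]
    | cons a L => simp [IsPath, dbFanout, ih, and_assoc]

theorem IsPath.take {x : List ℕ} {D : Finset (Fin n → ℕ)} {L : List (Fin n)}
    (h : IsPath x D L) (m : ℕ) : IsPath (x.take m) D L := by
  rw [isPath_iff_forall_get] at h ⊢
  refine ⟨(List.length_take_le' m x).trans h.1, fun j => ?_⟩
  have hj : j.1 < min m x.length := List.length_take (i := m) (l := x) ▸ j.2
  have := h.2 ⟨j.1, by omega⟩
  simpa [List.take_take, Nat.min_eq_left (show j.1 ≤ m by omega)] using this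

theorem IsPath.length_le {x : List ℕ} {D : Finset (Fin n → ℕ)} {L : List (Fin n)}
    (h : IsPath x D L) : x.length ≤ L.length :=
  ((isPath_iff_forall_get x D L).1 h).1

theorem dbValList_take (x : List ℕ) (D : Finset (Fin n → ℕ)) (L : List (Fin n)) (m : ℕ) :
    dbValList (x.take m) D L = (dbValList x D L).take m := by
  induction x generalizing D L m with
  | nil => simp [dbValList]
  | cons i xs ih =>
    cases m with
    | zero => simp [dbValList]
    | succ m => cases L <;> simp [dbValList, ih]

theorem IsPath.exists_dbValList_eq {x : List ℕ} {D : Finset (Fin n → ℕ)} {L : List (Fin n)}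
    (h : IsPath x D L) (hx : x ≠ []) :
    ∃ t ∈ D, dbValList x D L = (L.take x.length).map t := by
  induction x generalizing D L with
  | nil => exact absurd rfl hx
  | cons i xs ih =>
    cases L with
    | nil => exact h.elim
    | cons a L =>
      obtain ⟨⟨h1, h2⟩, h3⟩ := h
      rcases eq_or_ne xs [] with rfl | hxs
      · obtain ⟨t, ht, hta⟩ := Finset.mem_image.1 (nthVal_mem h1 h2)
        exact ⟨t, ht, by simp [dbValList, hta]⟩
      · obtain ⟨t, ht, hv⟩ := ih h3 hxs
        obtain ⟨htD, hta⟩ := Finset.mem_filter.1 ht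
        exact ⟨t, htD, by simp [dbValList, hv, hta]⟩

theorem IsPath.dbValList_injective {x y : List ℕ} {D : Finset (Fin n → ℕ)}
    {L : List (Fin n)} (hx : IsPath x D L) (hy : IsPath y D L)
    (h : dbValList x D L = dbValList y D L) : x = y := by
  induction x generalizing y D L with
  | nil =>
    cases y with
    | nil => rfl
    | cons j ys => cases L with
      | nil => exact hy.elim
      | cons a L => simp [dbValList] at h
  | cons i xs ih =>
    cases L with
    | nil => exact hx.elim
    | cons a L =>
      cases y with
      | nil => simp [dbValList] at h
      | cons j ys =>
        simp only [dbValList, List.cons.injEq] at h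
        obtain rfl := nthVal_injOn hx.1.1 hx.1.2 hy.1.1 hy.1.2 h.1
        rw [ih hx.2 hy.2 h.2]

/-- The search tree of `D` has at most `(|L| + 1) * |D|` nonempty index paths. -/
theorem exists_finset_isPath (D : Finset (Fin n → ℕ)) (L : List (Fin n)) :
    ∃ X : Finset (List ℕ), (∀ x, x ∈ X ↔ x ≠ [] ∧ IsPath x D L) ∧
      X.card ≤ (L.length + 1) * D.card := by
  classical
  let T : Finset (List ℕ) := (Finset.range (L.length + 1) ×ˢ D).image
    (fun q => (L.take q.1).map q.2)
  have hmaps : Set.MapsTo (fun x => dbValList x D L) {x | x ≠ [] ∧ IsPath x D L}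
      (T : Set (List ℕ)) := by
    rintro x ⟨hx, hp⟩
    obtain ⟨t, ht, hv⟩ := hp.exists_dbValList_eq hx
    have := hp.length_le
    exact Finset.mem_coe.2 (Finset.mem_image.2 ⟨(x.length, t),
      Finset.mem_product.2 ⟨Finset.mem_range.2 (by omega), ht⟩, hv.symm⟩)
  have hinj : Set.InjOn (fun x => dbValList x D L) {x | x ≠ [] ∧ IsPath x D L} :=
    fun x hx y hy h => hx.2.dbValList_injective hy.2 h
  have hfin := Set.Finite.of_injOn hmaps hinj T.finite_toSet
  refine ⟨hfin.toFinset, fun x => by simp, ?_⟩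
  calc hfin.toFinset.card ≤ T.card :=
        Finset.card_le_card_of_injOn _ (fun x hx => hmaps (by simpa using hx))
          (hinj.mono (by simp))
    _ ≤ _ := Finset.card_image_le.trans (by simp)

theorem IsInstVal.lt_of_lt {D : Finset (Fin n → ℕ)} {L : List (Fin n)} {v : List ℕ → ℕ}
    (hv : IsInstVal (fun y => dbFanout y D L) L.length v) {x : List ℕ} {i j : ℕ} (hij : i < j)
    (hi : IsPath (x ++ [i]) D L) (hj : IsPath (x ++ [j]) D L) :
    v (x ++ [i]) < v (x ++ [j]) := by
  induction j, hij using Nat.le_induction with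
  | base =>
    exact hv x i ((validIdx_dbFanout_iff _ _ _).2 ⟨by simp, hi⟩)
      ((validIdx_dbFanout_iff _ _ _).2 ⟨by simp, hj⟩)
  | succ m hm ih =>
    have hm' : IsPath (x ++ [m]) D L := by
      rw [isPath_append_singleton] at hi hj ⊢
      exact ⟨hi.1, hi.2.1, by omega, by omega⟩
    exact (ih hm').trans (hv x m ((validIdx_dbFanout_iff _ _ _).2 ⟨by simp, hm'⟩)
      ((validIdx_dbFanout_iff _ _ _).2 ⟨by simp, hj⟩))

theorem IsInstVal.eq_of_eq {D : Finset (Fin n → ℕ)} {L : List (Fin n)} {v : List ℕ → ℕ}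
    (hv : IsInstVal (fun y => dbFanout y D L) L.length v) {x : List ℕ} {i j : ℕ}
    (hi : IsPath (x ++ [i]) D L) (hj : IsPath (x ++ [j]) D L)
    (h : v (x ++ [i]) = v (x ++ [j])) : i = j := by
  rcases lt_trichotomy i j with hij | hij | hij
  · exact absurd h (hv.lt_of_lt hij hi hj).ne
  · exact hij
  · exact absurd h (hv.lt_of_lt hij hj hi).ne'

/-! ### Full relations -/

/-- The data `D` is unconstrained, with values below `N`, on the attributes in `L`. -/
def IsFull (N : ℕ) (D : Finset (Fin n → ℕ)) (L : List (Fin n)) : Prop :=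
  D.Nonempty ∧ ∀ t ∈ D, ∀ a ∈ L, t a < N ∧ ∀ w < N, Function.update t a w ∈ D

theorem IsFull.image_eq {N : ℕ} {D : Finset (Fin n → ℕ)} {a : Fin n} {L : List (Fin n)}
    (h : IsFull N D (a :: L)) : D.image (fun t => t a) = Finset.range N := by
  ext w
  rw [Finset.mem_image, Finset.mem_range]
  constructor
  · rintro ⟨t, ht, rfl⟩
    exact (h.2 t ht a (by simp)).1
  · intro hw
    obtain ⟨t, ht⟩ := h.1
    exact ⟨_, (h.2 t ht a (by simp)).2 w hw, by simp⟩

theorem IsFull.filter {N : ℕ} {D : Finset (Fin n → ℕ)} {a : Fin n} {L : List (Fin n)}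
    (h : IsFull N D (a :: L)) (ha : a ∉ L) {w : ℕ} (hw : w < N) :
    IsFull N (D.filter (fun t => t a = w)) L := by
  refine ⟨?_, fun t ht b hb => ?_⟩
  · obtain ⟨t, ht⟩ := h.1
    exact ⟨_, Finset.mem_filter.2 ⟨(h.2 t ht a (by simp)).2 w hw, by simp⟩⟩
  · obtain ⟨htD, hta⟩ := Finset.mem_filter.1 ht
    have hab : a ≠ b := fun e => ha (e ▸ hb)
    obtain ⟨h1, h2⟩ := h.2 t htD b (by simp [hb])
    exact ⟨h1, fun u hu => Finset.mem_filter.2 ⟨h2 u hu, by simp [hab, hta]⟩⟩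

theorem IsFull.isPath_iff {N : ℕ} {D : Finset (Fin n → ℕ)} {L : List (Fin n)}
    (h : IsFull N D L) (hL : L.Nodup) (x : List ℕ) :
    IsPath x D L ↔ x.length ≤ L.length ∧ ∀ i ∈ x, 1 ≤ i ∧ i ≤ N := by
  induction x generalizing D L with
  | nil => simp [IsPath]
  | cons i xs ih =>
    cases L with
    | nil => simp [IsPath]
    | cons a L =>
      rw [List.nodup_cons] at hL
      rw [IsPath, h.image_eq, Finset.card_range]
      by_cases hi : 1 ≤ i ∧ i ≤ N
      · rw [nthVal_range hi.1 hi.2, ih (h.filter hL.1 (by omega)) hL.2]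
        simp [hi]
      · simp [hi]

theorem IsFull.dbValList_eq {N : ℕ} {D : Finset (Fin n → ℕ)} {L : List (Fin n)}
    (h : IsFull N D L) (hL : L.Nodup) {x : List ℕ} (hx : IsPath x D L) :
    dbValList x D L = x.map (· - 1) := by
  induction x generalizing D L with
  | nil => simp [dbValList]
  | cons i xs ih =>
    cases L with
    | nil => exact hx.elim
    | cons a L =>
      rw [List.nodup_cons] at hL
      rw [IsPath, h.image_eq, Finset.card_range] at hx
      obtain ⟨hi, hx⟩ := hx
      rw [nthVal_range hi.1 hi.2] at hx
      rw [dbValList, h.image_eq]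
      simp only [nthVal_range hi.1 hi.2, List.map_cons]
      rw [ih (h.filter hL.1 (by omega)) hL.2 hx]

theorem exists_dbValue_eq {attrs : ι → Finset (Fin n)} {ρ : List (Fin n)}
    {DB : ι → Finset (Fin n → ℕ)} {R : ι} {x : List ℕ}
    (hx : IsPath x (DB R) (attrList attrs ρ R)) (hne : x ≠ []) :
    ∃ t ∈ DB R, ∀ (j : ℕ) (a : Fin n), j < x.length → (attrList attrs ρ R)[j]? = some a →
      dbValue attrs ρ DB R (x.take (j + 1)) = t a := by
  obtain ⟨t, ht, hv⟩ := hx.exists_dbValList_eq hne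
  refine ⟨t, ht, fun j a hj ha => ?_⟩
  have h1 : (x.take (j + 1)).length - 1 = j := by rw [List.length_take]; omega
  rw [dbValue, h1, dbValList_take, hv, List.getD_eq_getElem?_getD, List.getElem?_take]
  simp [ha, hj]

/-! ### The clique query -/

section Clique

variable {k N : ℕ}

theorem attrList_univ (ρ : List (Fin k)) : attrList (cliqueAttrs k) ρ (Sum.inr ()) = ρ := by
  simp [attrList, cliqueAttrs]

theorem mem_attrList_pair {ρ : List (Fin k)} {p : {p : Fin k × Fin k // p.1 ≠ p.2}}
    {a : Fin k} (h : a ∈ attrList (cliqueAttrs k) ρ (Sum.inl p)) :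
    a = p.val.1 ∨ a = p.val.2 := by
  simpa [attrList, cliqueAttrs] using (List.mem_filter.1 h).2

theorem exists_adj_of_mem_cliqueDB {G : SimpleGraph (Fin N)}
    {p : {p : Fin k × Fin k // p.1 ≠ p.2}} {t : Fin k → ℕ}
    (ht : t ∈ cliqueDB k N G (Sum.inl p)) :
    ∃ u w : Fin N, G.Adj u w ∧ t p.val.1 = u ∧ t p.val.2 = w := by
  obtain ⟨q, hq, rfl⟩ := Finset.mem_image.1 ht
  exact ⟨q.1, q.2, by simpa using hq, by simp, by simp [p.2.symm]⟩

theorem card_cliqueDB_pair_le (G : SimpleGraph (Fin N))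
    (p : {p : Fin k × Fin k // p.1 ≠ p.2}) :
    (cliqueDB k N G (Sum.inl p)).card ≤ 2 * G.edgeSet.ncard := by
  classical
  refine Finset.card_image_le.trans ?_
  rw [← SimpleGraph.coe_edgeFinset, Set.ncard_coe_finset,
    ← SimpleGraph.dart_card_eq_twice_card_edges, ← Finset.card_univ]
  exact Finset.card_le_card_of_surjOn (fun d : G.Dart => d.toProd) fun q hq =>
    ⟨⟨q, by simpa using hq⟩, by simp, rfl⟩

theorem isFull_cliqueDB (hN : 0 < N) (G : SimpleGraph (Fin N)) (ρ : List (Fin k)) :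
    IsFull N (cliqueDB k N G (Sum.inr ())) ρ := by
  refine ⟨⟨_, Finset.mem_image.2 ⟨fun _ => ⟨0, hN⟩, Finset.mem_univ _, rfl⟩⟩, fun t ht a _ => ?_⟩
  obtain ⟨g, -, rfl⟩ := Finset.mem_image.1 ht
  refine ⟨(g a).2, fun w hw => Finset.mem_image.2
    ⟨Function.update g a ⟨w, hw⟩, Finset.mem_univ _, ?_⟩⟩
  funext b
  by_cases hb : b = a
  · subst hb; simp
  · simp [hb]

/-- The index path in the search tree of `V^k` leading to the value `u` of attribute `a`
through first children only. -/
def anchorPath (ρ : List (Fin k)) (a : Fin k) (u : ℕ) : List ℕ :=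
  List.replicate (ρ.idxOf a) 1 ++ [u + 1]

/-- The index path in the search tree of `V^k` leading to the value `g a` of attribute `a`
along the tuple `g`. -/
def tuplePath (ρ : List (Fin k)) (g : Fin k → Fin N) (a : Fin k) : List ℕ :=
  (ρ.map (fun b => (g b : ℕ) + 1)).take (ρ.idxOf a + 1)

theorem tuplePath_eq_append {ρ : List (Fin k)} {a : Fin k} (ha : a ∈ ρ) (g : Fin k → Fin N) :
    tuplePath ρ g a =
      (ρ.map (fun b => (g b : ℕ) + 1)).take (ρ.idxOf a) ++ [(g a : ℕ) + 1] := by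
  have h := List.idxOf_lt_length_iff.2 ha
  rw [tuplePath, List.take_add_one]
  simp [h]

variable {ρ : List (Fin k)} {G : SimpleGraph (Fin N)}

theorem isPath_anchorPath (hρ : ρ.Nodup) {a : Fin k} (ha : a ∈ ρ) {u : ℕ} (hu : u < N) :
    IsPath (anchorPath ρ a u) (cliqueDB k N G (Sum.inr ())) ρ := by
  have h := List.idxOf_lt_length_iff.2 ha
  rw [(isFull_cliqueDB (by omega) G ρ).isPath_iff hρ]
  refine ⟨by simpa [anchorPath] using h, fun i hi => ?_⟩
  simp only [anchorPath, List.mem_append, List.mem_replicate, List.mem_singleton] at hi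
  omega

theorem isPath_tuplePath (hρ : ρ.Nodup) (g : Fin k → Fin N) (a : Fin k) :
    IsPath (tuplePath ρ g a) (cliqueDB k N G (Sum.inr ())) ρ := by
  have hN : 0 < N := (g a).pos
  refine IsPath.take ?_ _
  rw [(isFull_cliqueDB hN G ρ).isPath_iff hρ]
  refine ⟨by simp, fun i hi => ?_⟩
  obtain ⟨b, -, rfl⟩ := List.mem_map.1 hi
  omega

theorem dbValue_append_singleton (hN : 0 < N) (hρ : ρ.Nodup) {x : List ℕ} {u : ℕ}
    (h : IsPath (x ++ [u + 1]) (cliqueDB k N G (Sum.inr ())) ρ) :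
    dbValue (cliqueAttrs k) ρ (cliqueDB k N G) (Sum.inr ()) (x ++ [u + 1]) = u := by
  rw [dbValue, attrList_univ, (isFull_cliqueDB hN G ρ).dbValList_eq hρ h]
  simp

/-- In the valuation `v`, every variable of every edge relation agrees with the anchor of its
value in `G`, and so does every variable of `V^k` on the path of a `k`-clique. -/
def IsAnchored (ρ : List (Fin k)) (G : SimpleGraph (Fin N))
    (v : CliqueIdx k → List ℕ → ℕ) : Prop :=
  (∀ (p : {p : Fin k × Fin k // p.1 ≠ p.2}) (x : List ℕ) (a : Fin k),
    (x ≠ [] ∧ IsPath x (cliqueDB k N G (Sum.inl p)) (attrList (cliqueAttrs k) ρ (Sum.inl p))) →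
    (attrList (cliqueAttrs k) ρ (Sum.inl p))[x.length - 1]? = some a →
    v (Sum.inl p) x = v (Sum.inr ())
      (anchorPath ρ a (dbValue (cliqueAttrs k) ρ (cliqueDB k N G) (Sum.inl p) x))) ∧
  ∀ g : Fin k → Fin N, (∀ a b, a ≠ b → G.Adj (g a) (g b)) → ∀ a,
    v (Sum.inr ()) (tuplePath ρ g a) = v (Sum.inr ()) (anchorPath ρ a (g a))

theorem dbValue_pair_lt {p : {p : Fin k × Fin k // p.1 ≠ p.2}} {x : List ℕ}
    (hx : x ≠ []) (hp : IsPath x (cliqueDB k N G (Sum.inl p))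
      (attrList (cliqueAttrs k) ρ (Sum.inl p))) :
    dbValue (cliqueAttrs k) ρ (cliqueDB k N G) (Sum.inl p) x < N := by
  obtain ⟨t, ht, hv⟩ := exists_dbValue_eq hp hx
  have hpos := List.length_pos_iff.2 hx
  have hlt : x.length - 1 < (attrList (cliqueAttrs k) ρ (Sum.inl p)).length := by
    have := hp.length_le
    omega
  have h := hv (x.length - 1) _ (by omega) (List.getElem?_eq_getElem hlt)
  rw [Nat.sub_add_cancel hpos, List.take_length] at h
  obtain ⟨u, w, -, hu, hw⟩ := exists_adj_of_mem_cliqueDB ht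
  rw [h]
  rcases mem_attrList_pair (List.getElem_mem hlt) with e | e
  · rw [e, hu]; exact u.2
  · rw [e, hw]; exact w.2

theorem isAnchored_dbValue (hρ : ρ.Nodup) (hmem : ∀ a, a ∈ ρ) :
    IsAnchored ρ G (dbValue (cliqueAttrs k) ρ (cliqueDB k N G)) := by
  refine ⟨fun p x a hx _ => ?_, fun g _ a => ?_⟩
  · have hlt := dbValue_pair_lt hx.1 hx.2
    exact (dbValue_append_singleton (by omega) hρ (isPath_anchorPath hρ (hmem a) hlt)).symm
  · have h1 := isPath_tuplePath (G := G) hρ g a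
    rw [tuplePath_eq_append (hmem a)] at h1 ⊢
    rw [dbValue_append_singleton (g a).pos hρ h1]
    exact (dbValue_append_singleton (g a).pos hρ
      (isPath_anchorPath hρ (hmem a) (g a).2)).symm

theorem IsAnchored.isWitness_of_isWitness (hk : 2 ≤ k) (hρ : ρ.Nodup) (hmem : ∀ a, a ∈ ρ)
    {v v' : CliqueIdx k → List ℕ → ℕ} (hv : IsAnchored ρ G v) (hv' : IsAnchored ρ G v')
    (hinst : ∀ R, IsInstVal (dbShape (cliqueAttrs k) ρ (cliqueDB k N G) R)
      (arity (cliqueAttrs k) ρ R) (v R))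
    {W : CliqueIdx k → List ℕ}
    (hW : IsWitness (cliqueAttrs k) ρ (dbShape (cliqueAttrs k) ρ (cliqueDB k N G)) v W) :
    IsWitness (cliqueAttrs k) ρ (dbShape (cliqueAttrs k) ρ (cliqueDB k N G)) v' W := by
  obtain ⟨hval, t, ht⟩ := hW
  have hpath : ∀ R, W R ≠ [] ∧ IsPath (W R) (cliqueDB k N G R)
      (attrList (cliqueAttrs k) ρ R) := fun R => (validIdx_dbFanout_iff _ _ _).1 (hval R).1
  have hlen : ∀ R, (W R).length = (attrList (cliqueAttrs k) ρ R).length := fun R => (hval R).2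
  have hU : IsInstVal (fun y => dbFanout y (cliqueDB k N G (Sum.inr ())) ρ) ρ.length
      (v (Sum.inr ())) := by
    have h : IsInstVal (fun y => dbFanout y (cliqueDB k N G (Sum.inr ()))
        (attrList (cliqueAttrs k) ρ (Sum.inr ()))) (attrList (cliqueAttrs k) ρ (Sum.inr ())).length
        (v (Sum.inr ())) := hinst (Sum.inr ())
    rwa [attrList_univ] at h
  have hjlt : ∀ {R : CliqueIdx k} {j : ℕ} {a : Fin k},
      (attrList (cliqueAttrs k) ρ R)[j]? = some a → j < (W R).length := by
    intro R j a hj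
    rw [hlen]
    exact (List.getElem?_eq_some_iff.1 hj).1
  have htake : ∀ {R : CliqueIdx k} {j : ℕ} {a : Fin k},
      (attrList (cliqueAttrs k) ρ R)[j]? = some a → ((W R).take (j + 1)).length = j + 1 := by
    intro R j a hj
    have := hjlt hj
    rw [List.length_take]
    omega
  have hanchor : ∀ {z : CliqueIdx k → List ℕ → ℕ}, IsAnchored ρ G z →
      ∀ {p : {p : Fin k × Fin k // p.1 ≠ p.2}} {j : ℕ} {a : Fin k},
      (attrList (cliqueAttrs k) ρ (Sum.inl p))[j]? = some a →
      z (Sum.inl p) ((W (Sum.inl p)).take (j + 1)) = z (Sum.inr ()) (anchorPath ρ a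
        (dbValue (cliqueAttrs k) ρ (cliqueDB k N G) (Sum.inl p)
          ((W (Sum.inl p)).take (j + 1)))) := by
    intro z hz p j a hj
    refine hz.1 p _ a ⟨?_, (hpath _).2.take _⟩ ?_
    · rw [← List.length_pos_iff, htake hj]; omega
    · rw [htake hj]; exact hj
  have hltN : ∀ {p : {p : Fin k × Fin k // p.1 ≠ p.2}} {j : ℕ} {a : Fin k},
      (attrList (cliqueAttrs k) ρ (Sum.inl p))[j]? = some a →
      dbValue (cliqueAttrs k) ρ (cliqueDB k N G) (Sum.inl p)
          ((W (Sum.inl p)).take (j + 1)) < N := by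
    intro p j a hj
    refine dbValue_pair_lt ?_ ((hpath _).2.take _)
    rw [← List.length_pos_iff, htake hj]; omega
  have hidx : ∀ (p : {p : Fin k × Fin k // p.1 ≠ p.2}) (a : Fin k),
      a = p.val.1 ∨ a = p.val.2 → ∃ j : ℕ, (attrList (cliqueAttrs k) ρ (Sum.inl p))[j]? = some a := by
    intro p a ha
    rw [← List.mem_iff_getElem?]
    exact List.mem_filter.2 ⟨hmem a, by simpa [cliqueAttrs] using ha⟩
  have hex : ∀ a, ∃ u : Fin N, t a = v (Sum.inr ()) (anchorPath ρ a u) := by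
    intro a
    have : Nontrivial (Fin k) := Fin.nontrivial_iff_two_le.2 hk
    obtain ⟨b, hb⟩ := exists_ne a
    obtain ⟨j, hj⟩ := hidx ⟨(a, b), hb.symm⟩ a (Or.inl rfl)
    exact ⟨⟨_, hltN hj⟩, by rw [← ht _ j a hj, hanchor hv hj]⟩
  choose g hg using hex
  have hvalg : ∀ {p : {p : Fin k × Fin k // p.1 ≠ p.2}} {j : ℕ} {a : Fin k},
      (attrList (cliqueAttrs k) ρ (Sum.inl p))[j]? = some a →
      dbValue (cliqueAttrs k) ρ (cliqueDB k N G) (Sum.inl p)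
          ((W (Sum.inl p)).take (j + 1)) = g a := by
    intro p j a hj
    have h := (hanchor hv hj).symm.trans ((ht _ j a hj).trans (hg a))
    have := hU.eq_of_eq (isPath_anchorPath hρ (hmem a) (hltN hj))
      (isPath_anchorPath hρ (hmem a) (g a).2) h
    omega
  have hadj : ∀ a b, a ≠ b → G.Adj (g a) (g b) := by
    intro a b hab
    let p : {p : Fin k × Fin k // p.1 ≠ p.2} := ⟨(a, b), hab⟩
    obtain ⟨s, hs, hsv⟩ := exists_dbValue_eq (hpath (Sum.inl p)).2 (hpath _).1
    obtain ⟨u, w, huw, hu, hw⟩ := exists_adj_of_mem_cliqueDB hs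
    obtain ⟨i, hi⟩ := hidx p a (Or.inl rfl)
    obtain ⟨j, hj⟩ := hidx p b (Or.inr rfl)
    have h1 : g a = u := Fin.ext ((hvalg hi).symm.trans ((hsv i a (hjlt hi) hi).trans hu))
    have h2 : g b = w := Fin.ext ((hvalg hj).symm.trans ((hsv j b (hjlt hj) hj).trans hw))
    rwa [h1, h2]
  have hWlen : (W (Sum.inr ())).length = ρ.length := by rw [hlen, attrList_univ]
  have hWpath := (hpath (Sum.inr ())).2
  rw [attrList_univ] at hWpath
  have hWU : ∀ m ≤ ρ.length,
      (W (Sum.inr ())).take m = (ρ.map (fun b => (g b : ℕ) + 1)).take m := by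
    intro m
    induction m with
    | zero => simp
    | succ m ih =>
      intro hm
      have hidxm : ρ.idxOf ρ[m] = m := hρ.idxOf_getElem m hm
      have htp := tuplePath_eq_append (hmem ρ[m]) g
      rw [hidxm] at htp
      have hsplit : (W (Sum.inr ())).take (m + 1) =
          (ρ.map (fun b => (g b : ℕ) + 1)).take m ++ [(W (Sum.inr ()))[m]] := by
        rw [← ih (by omega), List.take_concat_get']
      have h1 : IsPath _ (cliqueDB k N G (Sum.inr ())) ρ := hWpath.take (m + 1)
      have h2 := isPath_tuplePath (G := G) hρ g ρ[m]
      have h3 := ht (Sum.inr ()) m ρ[m] (by rw [attrList_univ]; exact List.getElem?_eq_getElem hm)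
      rw [hg, ← hv.2 g hadj] at h3
      rw [hsplit] at h1 h3
      rw [htp] at h2 h3
      have hi := hU.eq_of_eq h1 h2 h3
      rw [hsplit, hi, ← htp, tuplePath, hidxm]
  refine ⟨hval, fun a => v' (Sum.inr ()) (anchorPath ρ a (g a)), ?_⟩
  rintro (p | ⟨⟩) j a hj
  · rw [hanchor hv' hj, hvalg hj]
  · rw [attrList_univ] at hj
    obtain ⟨hjl, rfl⟩ := List.getElem?_eq_some_iff.1 hj
    have h := hv'.2 g hadj ρ[j]
    rw [tuplePath, hρ.idxOf_getElem j hjl] at h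
    rw [hWU (j + 1) hjl]
    exact h

theorem card_clique_tuples_le (G : SimpleGraph (Fin N))
    (huniq : ∀ s t : Finset (Fin N), G.IsNClique k s → G.IsNClique k t → s = t)
    {T : Finset (Fin k → Fin N)} (hT : ∀ g ∈ T, ∀ a b, a ≠ b → G.Adj (g a) (g b)) :
    T.card ≤ k ^ k := by
  classical
  have hclique : ∀ g ∈ T, G.IsNClique k (Finset.univ.image g) := by
    intro g hg
    refine (SimpleGraph.isNClique_iff G).2 ⟨?_, ?_⟩
    · intro x hx y hy hxy
      simp only [Finset.coe_image, Finset.coe_univ, Set.image_univ] at hx hy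
      obtain ⟨a, rfl⟩ := hx
      obtain ⟨b, rfl⟩ := hy
      exact hT g hg a b fun e => hxy (e ▸ rfl)
    · rw [Finset.card_image_of_injective, Finset.card_univ, Fintype.card_fin]
      intro a b hab
      by_contra hne
      exact (hT g hg a b hne).ne hab
  rcases T.eq_empty_or_nonempty with rfl | ⟨g₀, hg₀⟩
  · simp
  · have hsub : T ⊆ Fintype.piFinset fun _ => Finset.univ.image g₀ := by
      intro g hg
      rw [Fintype.mem_piFinset, huniq _ _ (hclique g₀ hg₀) (hclique g hg)]
      simp
    refine (Finset.card_le_card hsub).trans ?_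
    simp [(hclique g₀ hg₀).card_eq]

/-- The comparisons expressing `IsAnchored`. -/
theorem exists_finset_comp_isAnchored (ρ : List (Fin k)) (G : SimpleGraph (Fin N))
    (huniq : ∀ s t : Finset (Fin N), G.IsNClique k s → G.IsNClique k t → s = t) :
    ∃ A : Finset (Comp (CliqueIdx k)),
      (∀ c, c ∈ A ↔
        (∃ (p : {p : Fin k × Fin k // p.1 ≠ p.2}) (x : List ℕ) (a : Fin k),
          (x ≠ [] ∧ IsPath x (cliqueDB k N G (Sum.inl p))
            (attrList (cliqueAttrs k) ρ (Sum.inl p))) ∧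
          (attrList (cliqueAttrs k) ρ (Sum.inl p))[x.length - 1]? = some a ∧
          c = ⟨Sum.inl p, x, Sum.inr (), anchorPath ρ a
            (dbValue (cliqueAttrs k) ρ (cliqueDB k N G) (Sum.inl p) x), Ordering.eq⟩) ∨
        ∃ (g : Fin k → Fin N) (a : Fin k), (∀ a b, a ≠ b → G.Adj (g a) (g b)) ∧
          c = ⟨Sum.inr (), tuplePath ρ g a, Sum.inr (), anchorPath ρ a (g a), Ordering.eq⟩) ∧
      A.card ≤ k * k * ((ρ.length + 1) * (2 * G.edgeSet.ncard) * k) + k ^ k * k := by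
  classical
  choose X hX hXcard using fun p : {p : Fin k × Fin k // p.1 ≠ p.2} =>
    exists_finset_isPath (cliqueDB k N G (Sum.inl p)) (attrList (cliqueAttrs k) ρ (Sum.inl p))
  let A₁ : Finset (Comp (CliqueIdx k)) := Finset.univ.biUnion fun p =>
    ((X p ×ˢ (Finset.univ : Finset (Fin k))).filter fun q =>
      (attrList (cliqueAttrs k) ρ (Sum.inl p))[q.1.length - 1]? = some q.2).image fun q =>
        ⟨Sum.inl p, q.1, Sum.inr (), anchorPath ρ q.2
          (dbValue (cliqueAttrs k) ρ (cliqueDB k N G) (Sum.inl p) q.1), Ordering.eq⟩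
  let T : Finset (Fin k → Fin N) :=
    Finset.univ.filter fun g => ∀ a b, a ≠ b → G.Adj (g a) (g b)
  let A₂ : Finset (Comp (CliqueIdx k)) := (T ×ˢ (Finset.univ : Finset (Fin k))).image fun q =>
    ⟨Sum.inr (), tuplePath ρ q.1 q.2, Sum.inr (), anchorPath ρ q.2 (q.1 q.2), Ordering.eq⟩
  refine ⟨A₁ ∪ A₂, fun c => ?_, (Finset.card_union_le _ _).trans (Nat.add_le_add ?_ ?_)⟩
  · rw [Finset.mem_union]
    refine or_congr ?_ ?_
    · simp only [A₁, Finset.mem_biUnion, Finset.mem_univ, true_and, Finset.mem_image,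
        Finset.mem_filter, Finset.mem_product, and_true, hX, Prod.exists]
      constructor
      · rintro ⟨p, x, a, ⟨h1, h2⟩, rfl⟩
        exact ⟨p, x, a, h1, h2, rfl⟩
      · rintro ⟨p, x, a, h1, h2, rfl⟩
        exact ⟨p, x, a, ⟨h1, h2⟩, rfl⟩
    · simp only [A₂, T, Finset.mem_image, Finset.mem_product, Finset.mem_filter,
        Finset.mem_univ, true_and, and_true, Prod.exists]
      constructor
      · rintro ⟨g, a, h, rfl⟩
        exact ⟨g, a, h, rfl⟩
      · rintro ⟨g, a, h, rfl⟩
        exact ⟨g, a, h, rfl⟩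
  · have hcard : (Finset.univ : Finset {p : Fin k × Fin k // p.1 ≠ p.2}).card ≤ k * k := by
      rw [Finset.card_univ]
      exact (Fintype.card_subtype_le _).trans (by simp)
    refine (Finset.card_biUnion_le_card_mul _ _ ((ρ.length + 1) * (2 * G.edgeSet.ncard) * k)
      fun p _ => ?_).trans (Nat.mul_le_mul_right _ hcard)
    refine Finset.card_image_le.trans ((Finset.card_filter_le _ _).trans ?_)
    rw [Finset.card_product, Finset.card_univ, Fintype.card_fin]
    refine Nat.mul_le_mul_right _ ((hXcard p).trans (Nat.mul_le_mul ?_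
      (card_cliqueDB_pair_le G p)))
    exact Nat.succ_le_succ (List.length_filter_le _ _)
  · refine Finset.card_image_le.trans ?_
    rw [Finset.card_product, Finset.card_univ, Fintype.card_fin]
    exact Nat.mul_le_mul_right _
      (card_clique_tuples_le G huniq fun g hg => (Finset.mem_filter.1 hg).2)

end Clique

/-- For every `k ≥ 3` there is a constant `c_k` such that: for every graph `G` on `Fin N`
with at most one `k`-clique, the clique-query instance
`Q_k = (⋈_{i≠j} R_{i,j}(v_i, v_j)) ⋈ U(v_1, …, v_k)`, with any fixed GAO, admits a
certificate of size at most `c_k ⬝ (|E| + log(|V| + 2))`. -/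
theorem stmt_15 :
    ∀ k : ℕ, 3 ≤ k → ∃ c : ℕ, 0 < c ∧
      ∀ (N : ℕ) (G : SimpleGraph (Fin N)),
        (∀ s t : Finset (Fin N), G.IsNClique k s → G.IsNClique k t → s = t) →
        ∀ ρ : List (Fin k), ρ.Nodup → (∀ a : Fin k, a ∈ ρ) →
          ∃ A : Finset (Comp (CliqueIdx k)),
            IsCert (cliqueAttrs k) ρ (dbShape (cliqueAttrs k) ρ (cliqueDB k N G)) A ∧
            (∀ cc ∈ A, SatComp (dbValue (cliqueAttrs k) ρ (cliqueDB k N G)) cc) ∧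
            A.card ≤ c * (G.edgeSet.ncard + Nat.log 2 (N + 2)) := by
  intro k hk
  refine ⟨k * k * ((k + 1) * 2 * k) + k ^ k * k, by positivity, fun N G huniq ρ hρ hmem => ?_⟩
  obtain ⟨A, hA, hcard⟩ := exists_finset_comp_isAnchored ρ G huniq
  have hsat : ∀ v, (∀ c ∈ A, SatComp v c) ↔ IsAnchored ρ G v := by
    intro v
    constructor
    · intro h
      exact ⟨fun p x a hx ha =>
          compare_eq_iff_eq.1 (h _ ((hA _).2 (Or.inl ⟨p, x, a, hx, ha, rfl⟩))),
        fun g hg a => compare_eq_iff_eq.1 (h _ ((hA _).2 (Or.inr ⟨g, a, hg, rfl⟩)))⟩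
    · intro h c hc
      rcases (hA c).1 hc with ⟨p, x, a, hx, ha, rfl⟩ | ⟨g, a, hg, rfl⟩
      · exact compare_eq_iff_eq.2 (h.1 p x a hx ha)
      · exact compare_eq_iff_eq.2 (h.2 g hg a)
  have hvalid : ∀ x, x ≠ [] → IsPath x (cliqueDB k N G (Sum.inr ())) ρ →
      ValidIdx (dbShape (cliqueAttrs k) ρ (cliqueDB k N G) (Sum.inr ()))
        (arity (cliqueAttrs k) ρ (Sum.inr ())) x := by
    intro x hx hp
    refine (validIdx_dbFanout_iff _ _ _).2 ⟨hx, ?_⟩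
    rwa [attrList_univ]
  have hanchor : ∀ a u, ρ[(anchorPath ρ a u).length - 1]? = some a := by
    intro a u
    simp [anchorPath, List.getElem?_eq_getElem (List.idxOf_lt_length_iff.2 (hmem a))]
  refine ⟨A, ⟨fun c hc => ?_, fun v v' hv hv' hsv hsv' W => ?_⟩,
    (hsat _).2 (isAnchored_dbValue hρ hmem), ?_⟩
  · rcases (hA c).1 hc with ⟨p, x, a, hx, ha, rfl⟩ | ⟨g, a, hg, rfl⟩
    · refine ⟨(validIdx_dbFanout_iff _ _ _).2 hx, hvalid _ (by simp [anchorPath])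
        (isPath_anchorPath hρ (hmem a) (dbValue_pair_lt hx.1 hx.2)), ?_⟩
      simp only [attrList_univ, hanchor]
      exact ha
    · refine ⟨hvalid _ (by simp [tuplePath_eq_append (hmem a)]) (isPath_tuplePath hρ g a),
        hvalid _ (by simp [anchorPath]) (isPath_anchorPath hρ (hmem a) (g a).2), ?_⟩
      have h := List.idxOf_lt_length_iff.2 (hmem a)
      congr 1
      simp [tuplePath, anchorPath]
      omega
  · exact ⟨((hsat v).1 hsv).isWitness_of_isWitness (by omega) hρ hmem ((hsat v').1 hsv') hv,
      ((hsat v').1 hsv').isWitness_of_isWitness (by omega) hρ hmem ((hsat v).1 hsv) hv'⟩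
  · have hlen : ρ.length ≤ k := by simpa using hρ.length_le_card
    have hlog : 1 ≤ Nat.log 2 (N + 2) := Nat.log_pos (by omega) (by omega)
    calc A.card ≤ k * k * ((ρ.length + 1) * (2 * G.edgeSet.ncard) * k) + k ^ k * k := hcard
      _ ≤ k * k * ((k + 1) * (2 * G.edgeSet.ncard) * k) + k ^ k * k * Nat.log 2 (N + 2) := by
        refine Nat.add_le_add ?_ (Nat.le_mul_of_pos_right _ hlog)
        gcongr
      _ ≤ (k * k * ((k + 1) * 2 * k) + k ^ k * k) *
          (G.edgeSet.ncard + Nat.log 2 (N + 2)) := by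
        generalize k ^ k * k = M
        generalize G.edgeSet.ncard = E
        generalize Nat.log 2 (N + 2) = l
        have h1 : 0 ≤ M * E := Nat.zero_le _
        have h2 : 0 ≤ k * k * ((k + 1) * 2 * k) * l := Nat.zero_le _
        nlinarith
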